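/- Suppose ε₁ε₂ε₃ = −1 and let (S₁, S₂, S₃) be an ε-hypersymplectic structure on (E, B, b). Then for all i ≠ j in {1, 2, 3}, each of the pairs (S_i, S_j), (T_i, T_j) and (S_i, T_j) is a Nijenhuis pair, i.e. the two endomorphisms anti-commute, both have vanishing Nijenhuis torsion with respect to b, and their concomitant C_b vanishes identically. -/

import Mathlib

variable {E : Type*} [AddCommGroup E] [Module ℝ E]

/-- The deformed bracket `b_I(X,Y) = b(I X, Y) + b(X, I Y) - I (b(X,Y))`. -/
noncomputable def deform (b : E →ₗ[ℝ] E →ₗ[ℝ] E) (I : E →ₗ[ℝ] E) :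
    E →ₗ[ℝ] E →ₗ[ℝ] E :=
  b ∘ₗ I + LinearMap.compl₂ b I - LinearMap.compr₂ b I

/-- The Nijenhuis torsion of `I` with respect to `b`:
`T_b I (X,Y) = b(I X, I Y) - I (b_I(X,Y))`. -/
noncomputable def torsion (b : E →ₗ[ℝ] E →ₗ[ℝ] E) (I : E →ₗ[ℝ] E) (X Y : E) : E :=
  b (I X) (I Y) - I (deform b I X Y)

/-- The concomitant `C_b(I,J)(X,Y) = b_{I,J}(X,Y) + b_{J,I}(X,Y)`. -/
noncomputable def concomitant (b : E →ₗ[ℝ] E →ₗ[ℝ] E) (I J : E →ₗ[ℝ] E) (X Y : E) : E :=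
  deform (deform b I) J X Y + deform (deform b J) I X Y

/-- An ε-hypersymplectic structure on `(E, B, b)`: a triple `S i` (indices in `ZMod 3`,
with `3 ≡ 0`) of `B`-skew-symmetric endomorphisms such that `S i ∘ S i = ε i • id`,
`S i ∘ S j = ε₁ε₂ε₃ • (S j ∘ S i)` for `i ≠ j`, and `b_{S i, S i} = ε i • b`. -/
noncomputable def IsEpsHypersymplectic (B : E →ₗ[ℝ] E →ₗ[ℝ] ℝ) (b : E →ₗ[ℝ] E →ₗ[ℝ] E)
    (ε : ZMod 3 → ℝ) (S : ZMod 3 → E →ₗ[ℝ] E) : Prop :=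
  (∀ i, ∀ X Y : E, B (S i X) Y = - B X (S i Y)) ∧
  (∀ i, S i ∘ₗ S i = ε i • (LinearMap.id : E →ₗ[ℝ] E)) ∧
  (∀ i j, i ≠ j → S i ∘ₗ S j = (ε 0 * ε 1 * ε 2) • (S j ∘ₗ S i)) ∧
  (∀ i, deform (deform b (S i)) (S i) = ε i • b)

/-- The transition endomorphisms `T i := ε (i-1) • (S (i-1) ∘ S (i+1))`. -/
noncomputable def transMor (ε : ZMod 3 → ℝ) (S : ZMod 3 → E →ₗ[ℝ] E) (i : ZMod 3) :
    E →ₗ[ℝ] E :=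
  ε (i - 1) • (S (i - 1) ∘ₗ S (i + 1))

/-- The endomorphism `G := S₃ ∘ S₂ ∘ S₁` (with `S₃ = S 0`). -/
noncomputable def metricG (S : ZMod 3 → E →ₗ[ℝ] E) : E →ₗ[ℝ] E :=
  S 0 ∘ₗ S 2 ∘ₗ S 1
/-- A Nijenhuis pair: two anti-commuting endomorphisms, both with vanishing Nijenhuis
torsion with respect to the bracket, whose concomitant vanishes identically. -/
noncomputable def NijenhuisPair (b : E →ₗ[ℝ] E →ₗ[ℝ] E) (I J : E →ₗ[ℝ] E) : Prop :=
  I ∘ₗ J = -(J ∘ₗ I) ∧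
  (∀ X Y : E, torsion b I X Y = 0) ∧
  (∀ X Y : E, torsion b J X Y = 0) ∧
  (∀ X Y : E, concomitant b I J X Y = 0)

theorem deform_apply (b : E →ₗ[ℝ] E →ₗ[ℝ] E) (I : E →ₗ[ℝ] E) (X Y : E) :
    deform b I X Y = b (I X) Y + b X (I Y) - I (b X Y) := by
  simp [deform]

theorem torsion_smul (b : E →ₗ[ℝ] E →ₗ[ℝ] E) (r : ℝ) (I : E →ₗ[ℝ] E) (X Y : E) :
    torsion b (r • I) X Y = (r * r) • torsion b I X Y := by
  simp only [torsion, deform_apply, LinearMap.smul_apply, map_smul, map_add, map_sub]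
  module

theorem torsion_eq_zero_of_deform_deform {b : E →ₗ[ℝ] E →ₗ[ℝ] E} {I : E →ₗ[ℝ] E} {a : ℝ}
    (hI : ∀ X, I (I X) = a • X) (h : deform (deform b I) I = a • b) (X Y : E) :
    torsion b I X Y = 0 := by
  have h' := LinearMap.congr_fun₂ h X Y
  simp only [deform_apply, LinearMap.smul_apply, map_smul, map_add, map_sub, hI] at h'
  simp only [torsion, deform_apply, map_add, map_sub, hI]
  linear_combination (norm := module) (1 / 2 : ℝ) • h'

/-- The concomitant of two anti-commuting torsionless endomorphisms squaring to `±id` vanishes. -/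
theorem concomitant_eq_zero_of_torsion_eq_zero {b : E →ₗ[ℝ] E →ₗ[ℝ] E} {I J : E →ₗ[ℝ] E}
    {a c : ℝ} (ha : a = 1 ∨ a = -1) (hc : c = 1 ∨ c = -1)
    (hI : ∀ X, I (I X) = a • X) (hJ : ∀ X, J (J X) = c • X)
    (hIJ : ∀ X, J (I X) = -I (J X))
    (tI : ∀ X Y, torsion b I X Y = 0) (tJ : ∀ X Y, torsion b J X Y = 0) (X Y : E) :
    concomitant b I J X Y = 0 := by
  have h₁ := congrArg I (tI (I X) (I (J Y)))
  have h₂ := tJ X (I (J Y))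
  have h₃ := congrArg (fun Z => I (J Z)) (tJ (I (J X)) (I (J Y)))
  have h₄ := congrArg (fun Z => I (J Z)) (tJ X Y)
  have h₅ := congrArg J (tJ (I X) Y)
  have h₆ := congrArg I (tI (I (J X)) (I Y))
  have h₇ := congrArg (fun Z => I (J Z)) (tI X Y)
  have h₈ := congrArg J (tI (J X) (I (J Y)))
  simp only [torsion, concomitant, deform_apply, map_add, map_sub, map_neg, map_smul, map_zero,
    LinearMap.neg_apply, LinearMap.smul_apply, hI, hJ, hIJ]
    at h₁ h₂ h₃ h₄ h₅ h₆ h₇ h₈ ⊢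
  linear_combination (norm := skip)
    (-1 : ℝ) • h₁ + (-c) • h₂ + a • h₃ + c • h₄ +
    (-c) • h₅ + (-1 : ℝ) • h₆ + (-a) • h₇ + (-(a * c)) • h₈
  rcases ha with rfl | rfl <;> rcases hc with rfl | rfl <;> module

/-- The composite of two anti-commuting torsionless endomorphisms squaring to `±id` is
torsionless. -/
theorem torsion_comp_eq_zero {b : E →ₗ[ℝ] E →ₗ[ℝ] E} {I J : E →ₗ[ℝ] E}
    {a c : ℝ} (ha : a = 1 ∨ a = -1) (hc : c = 1 ∨ c = -1)
    (hI : ∀ X, I (I X) = a • X) (hJ : ∀ X, J (J X) = c • X)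
    (hIJ : ∀ X, J (I X) = -I (J X))
    (tI : ∀ X Y, torsion b I X Y = 0) (tJ : ∀ X Y, torsion b J X Y = 0) (X Y : E) :
    torsion b (I ∘ₗ J) X Y = 0 := by
  have h₁ := congrArg J (tJ X (J Y))
  have h₂ := congrArg I (tI X (I Y))
  have h₃ := tJ (I (J X)) (I (J Y))
  have h₄ := congrArg I (tJ X (I Y))
  have h₅ := congrArg I (tJ (I X) Y)
  have h₆ := tI (J X) (J Y)
  have h₇ := congrArg (fun Z => I (J Z)) (tI (I X) (J Y))
  have h₈ := congrArg J (tI (J X) Y)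
  simp only [torsion, deform_apply, LinearMap.comp_apply, map_add, map_sub, map_neg,
    map_smul, map_zero, LinearMap.neg_apply, LinearMap.smul_apply, hI, hJ, hIJ]
    at h₁ h₂ h₃ h₄ h₅ h₆ h₇ h₈ ⊢
  linear_combination (norm := skip)
    (1 / 2 * (a * c) : ℝ) • h₁ + (1 / 2 * (a * c) : ℝ) • h₂ +
    (1 / 2 * c : ℝ) • h₃ + (-1 / 2 : ℝ) • h₄ +
    (-1 / 2 : ℝ) • h₅ + (1 / 2 : ℝ) • h₆ + (-1 / 2 * a : ℝ) • h₇ + (-1 / 2 : ℝ) • h₈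
  rcases ha with rfl | rfl <;> rcases hc with rfl | rfl <;> module

theorem nijenhuisPair_of_torsion_eq_zero {b : E →ₗ[ℝ] E →ₗ[ℝ] E} {I J : E →ₗ[ℝ] E}
    {a c : ℝ} (ha : a = 1 ∨ a = -1) (hc : c = 1 ∨ c = -1)
    (hI : ∀ X, I (I X) = a • X) (hJ : ∀ X, J (J X) = c • X)
    (hIJ : ∀ X, J (I X) = -I (J X))
    (tI : ∀ X Y, torsion b I X Y = 0) (tJ : ∀ X Y, torsion b J X Y = 0) :
    NijenhuisPair b I J :=
  ⟨by ext X; simp [hIJ], tI, tJ,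
    concomitant_eq_zero_of_torsion_eq_zero ha hc hI hJ hIJ tI tJ⟩

section Transition

variable {ε : ZMod 3 → ℝ} {S : ZMod 3 → E →ₗ[ℝ] E}

theorem transMor_apply_apply (hε : ∀ i, ε i = 1 ∨ ε i = -1)
    (hsq : ∀ i X, S i (S i X) = ε i • X)
    (hanti : ∀ i j, i ≠ j → ∀ X, S j (S i X) = -S i (S j X)) (i : ZMod 3) (X : E) :
    transMor ε S i (transMor ε S i X) = (-(ε (i - 1) * ε (i + 1))) • X := by
  have hne : i + 1 ≠ i - 1 := by revert i; decide
  simp only [transMor, LinearMap.smul_apply, LinearMap.comp_apply, map_smul, map_neg, hsq,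
    hanti _ _ hne.symm]
  rcases hε (i - 1) with h | h <;> rw [h] <;> module

theorem transMor_anticomm (hsq : ∀ i X, S i (S i X) = ε i • X)
    (hanti : ∀ i j, i ≠ j → ∀ X, S j (S i X) = -S i (S j X)) {i j : ZMod 3} (hij : i ≠ j)
    (X : E) : transMor ε S j (transMor ε S i X) = -transMor ε S i (transMor ε S j X) := by
  have h₀₁ := hanti 0 1 (by decide)
  have h₀₂ := hanti 0 2 (by decide)
  have h₁₂ := hanti 1 2 (by decide)
  have e₁ : (0 - 1 : ZMod 3) = 2 := rfl
  have e₂ : (1 + 1 : ZMod 3) = 2 := rfl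
  have e₃ : (2 + 1 : ZMod 3) = 0 := rfl
  have e₄ : (2 - 1 : ZMod 3) = 1 := rfl
  have hcases : ∀ k : ZMod 3, k = 0 ∨ k = 1 ∨ k = 2 := by decide
  rcases hcases i with rfl | rfl | rfl <;> rcases hcases j with rfl | rfl | rfl <;>
    first
    | exact absurd rfl hij
    | simp only [transMor, e₁, e₂, e₃, e₄, sub_self, zero_add, LinearMap.smul_apply,
        LinearMap.comp_apply, map_smul, map_neg, hsq, h₀₁, h₀₂, h₁₂]
      module

theorem transMor_anticomm_of_ne (hsq : ∀ i X, S i (S i X) = ε i • X)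
    (hanti : ∀ i j, i ≠ j → ∀ X, S j (S i X) = -S i (S j X)) {i j : ZMod 3} (hij : i ≠ j)
    (X : E) : transMor ε S j (S i X) = -S i (transMor ε S j X) := by
  have hne : ∀ j : ZMod 3, j - 1 ≠ j + 1 := by decide
  have hi : i = j - 1 ∨ i = j + 1 := by revert hij; revert i j; decide
  rcases hi with rfl | rfl <;>
    simp only [transMor, LinearMap.smul_apply, LinearMap.comp_apply, map_smul, map_neg, hsq,
      hanti _ _ (hne j)] <;>
    module

end Transition

theorem statement11 (B : E →ₗ[ℝ] E →ₗ[ℝ] ℝ) (b : E →ₗ[ℝ] E →ₗ[ℝ] E)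
    (ε : ZMod 3 → ℝ) (S : ZMod 3 → E →ₗ[ℝ] E)
    (hε : ∀ i, ε i = 1 ∨ ε i = -1)
    (hBsymm : ∀ X Y : E, B X Y = B Y X)
    (hBnd : ∀ X : E, (∀ Y : E, B X Y = 0) → X = 0)
    (he : ε 0 * ε 1 * ε 2 = -1)
    (hS : IsEpsHypersymplectic B b ε S) :
    ∀ i j : ZMod 3, i ≠ j →
      NijenhuisPair b (S i) (S j) ∧
      NijenhuisPair b (transMor ε S i) (transMor ε S j) ∧
      NijenhuisPair b (S i) (transMor ε S j) := by
  obtain ⟨-, hsq, hcomm, hdef⟩ := hS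
  replace hsq : ∀ i X, S i (S i X) = ε i • X := fun i X => LinearMap.congr_fun (hsq i) X
  have hanti : ∀ i j, i ≠ j → ∀ X, S j (S i X) = -S i (S j X) := fun i j hij X => by
    simpa [he] using LinearMap.congr_fun (hcomm j i hij.symm) X
  have tS i : ∀ X Y, torsion b (S i) X Y = 0 :=
    torsion_eq_zero_of_deform_deform (hsq i) (hdef i)
  have tT i : ∀ X Y, torsion b (transMor ε S i) X Y = 0 := fun X Y => by
    have hne : i - 1 ≠ i + 1 := by revert i; decide
    rw [transMor, torsion_smul, torsion_comp_eq_zero (hε _) (hε _) (hsq _) (hsq _)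
      (hanti _ _ hne) (tS _) (tS _), smul_zero]
  have hT := transMor_apply_apply hε hsq hanti
  have hsign : ∀ i : ZMod 3, -(ε (i - 1) * ε (i + 1)) = 1 ∨ -(ε (i - 1) * ε (i + 1)) = -1 :=
    fun i => by
      rcases hε (i - 1) with h | h <;> rcases hε (i + 1) with h' | h' <;> simp [h, h']
  exact fun i j hij =>
    ⟨nijenhuisPair_of_torsion_eq_zero (hε i) (hε j) (hsq i) (hsq j) (hanti i j hij) (tS i) (tS j),
      nijenhuisPair_of_torsion_eq_zero (hsign i) (hsign j) (hT i) (hT j)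
        (transMor_anticomm hsq hanti hij) (tT i) (tT j),
      nijenhuisPair_of_torsion_eq_zero (hε i) (hsign j) (hsq i) (hT j)
        (transMor_anticomm_of_ne hsq hanti hij) (tS i) (tT j)⟩
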